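/- arXiv:1310.4356 — 3 statements merged into one kernel-verified Lean document; each statement's English description precedes it below -/
import Mathlib

section
/- Let μ be a finite positive Borel measure on ℝ with compact support, let m ≥ 0, let Q be a real polynomial orthogonal to all polynomials of degree < m with respect to μ (i.e. ∫ x^k Q(x) dμ(x) = 0 for every 0 ≤ k < m), and let P be a real polynomial of degree ≤ m. Then for every z ∈ ℂ \ supp μ one has ∫ P(x) Q(x) / (z − x) dμ(x) = P(z) · ∫ Q(x) / (z − x) dμ(x). In particular, taking P = Q = q_n with m = n, the diagonal Green function satisfies ∫ q_n(x)² / (z − x) dμ(x) = q_n(z) r_n(z), where r_n(z) = ∫ q_n(x)/(z − x) dμ(x). -/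
open Polynomial MeasureTheory

/-- The (closed) support of a Borel measure on ℝ: the set of points all of whose
neighborhoods have positive measure. -/
def measureSupport (μ : Measure ℝ) : Set ℝ := {x : ℝ | ∀ U ∈ nhds x, μ U ≠ 0}

lemma ms_compl_null (μ : Measure ℝ) : μ (measureSupport μ)ᶜ = 0 := by
  refine measure_null_of_locally_null _ ?_
  intro x hx
  simp only [measureSupport, Set.mem_compl_iff, Set.mem_ofPred_eq, not_forall, not_not] at hx
  obtain ⟨U, hU, h0⟩ := hx
  exact ⟨U, mem_nhdsWithin_of_mem_nhds hU, h0⟩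

lemma ms_integrable (μ : Measure ℝ) [IsFiniteMeasure μ]
    (hcomp : IsCompact (measureSupport μ)) (f : ℝ → ℂ)
    (hf : ContinuousOn f (measureSupport μ)) : Integrable f μ := by
  have h := hf.integrableOn_compact (μ := μ) hcomp
  rwa [IntegrableOn, Measure.restrict_eq_self_of_ae_mem] at h
  exact ms_compl_null μ

lemma ms_power (μ : Measure ℝ) [IsFiniteMeasure μ]
    (hcomp : IsCompact (measureSupport μ))
    (m : ℕ) (Q : Polynomial ℝ)
    (hQ : ∀ k : ℕ, k < m → ∫ x, x ^ k * Q.eval x ∂μ = 0)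
    (z : ℂ) (hz : ∀ x ∈ measureSupport μ, (x : ℂ) ≠ z)
    (hi : ∀ k : ℕ, Integrable (fun x : ℝ => (x : ℂ) ^ k * (((Q.eval x : ℝ) : ℂ) / (z - (x : ℂ)))) μ)
    (k : ℕ) (hk : k ≤ m) :
    ∫ x : ℝ, (x : ℂ) ^ k * (((Q.eval x : ℝ) : ℂ) / (z - (x : ℂ))) ∂μ
      = z ^ k * ∫ x, ((Q.eval x : ℝ) : ℂ) / (z - (x : ℂ)) ∂μ := by
  induction k with
  | zero => simp
  | succ k ih =>
    have h1 : ∫ x : ℝ, (x : ℂ) ^ (k+1) * (((Q.eval x : ℝ) : ℂ) / (z - (x : ℂ))) ∂μ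
        = ∫ x : ℝ, (z * ((x : ℂ) ^ k * (((Q.eval x : ℝ) : ℂ) / (z - (x : ℂ))))
            - ((x ^ k * Q.eval x : ℝ) : ℂ)) ∂μ := by
      refine integral_congr_ae ?_
      have hae : ∀ᵐ x ∂μ, x ∈ measureSupport μ := ms_compl_null μ
      filter_upwards [hae] with x hx
      have h : z - (x : ℂ) ≠ 0 := sub_ne_zero.2 (hz x hx).symm
      push_cast
      field_simp
      ring
    have h2 : Integrable (fun x : ℝ => ((x ^ k * Q.eval x : ℝ) : ℂ)) μ :=
      ms_integrable μ hcomp _ (by fun_prop)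
    rw [h1, integral_sub ((hi k).const_mul z) h2, integral_const_mul, ih (by omega),
      integral_complex_ofReal, hQ k (by omega)]
    push_cast
    ring

/-- If `Q` is orthogonal to all polynomials of degree `< m` w.r.t. a compactly supported
finite measure `μ` and `deg P ≤ m`, then for `z ∉ supp μ`,
`∫ P(x)Q(x)/(z−x) dμ(x) = P(z) ∫ Q(x)/(z−x) dμ(x)`. -/
theorem green_function_factorization
    (μ : Measure ℝ) [IsFiniteMeasure μ]
    (hcomp : IsCompact (measureSupport μ))
    (m : ℕ) (Q P : Polynomial ℝ)
    (hQ : ∀ k : ℕ, k < m → ∫ x, x ^ k * Q.eval x ∂μ = 0)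
    (hP : P.degree ≤ m) :
    ∀ z : ℂ, (∀ x ∈ measureSupport μ, (x : ℂ) ≠ z) →
      ∫ x, ((P.eval x * Q.eval x : ℝ) : ℂ) / (z - (x : ℂ)) ∂μ
        = Polynomial.aeval z P * ∫ x, ((Q.eval x : ℝ) : ℂ) / (z - (x : ℂ)) ∂μ := by
  intro z hz
  have hi : ∀ k : ℕ, Integrable
      (fun x : ℝ => (x : ℂ) ^ k * (((Q.eval x : ℝ) : ℂ) / (z - (x : ℂ)))) μ := by
    intro k
    refine ms_integrable μ hcomp _ (ContinuousOn.mul (by fun_prop)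
      (ContinuousOn.div (by fun_prop) (by fun_prop) ?_))
    intro x hx
    exact sub_ne_zero.2 (hz x hx).symm
  have hd : P.natDegree < m + 1 := Nat.lt_succ_of_le (natDegree_le_of_degree_le hP)
  have h1 : ∀ x : ℝ, ((P.eval x * Q.eval x : ℝ) : ℂ) / (z - (x : ℂ))
      = ∑ k ∈ Finset.range (m + 1), (P.coeff k : ℂ) *
        ((x : ℂ) ^ k * (((Q.eval x : ℝ) : ℂ) / (z - (x : ℂ)))) := by
    intro x
    rw [eval_eq_sum_range' hd x]
    push_cast
    rw [mul_div_assoc, Finset.sum_mul]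
    exact Finset.sum_congr rfl fun k _ => by ring
  simp_rw [h1]
  rw [integral_finsetSum _ (fun k _ => (hi k).const_mul _), aeval_eq_sum_range' hd z,
    Finset.sum_mul]
  refine Finset.sum_congr rfl fun k hk => ?_
  rw [integral_const_mul, ms_power μ hcomp m Q hQ z hz hi k
    (Nat.lt_succ_iff.1 (Finset.mem_range.1 hk)), Complex.real_smul]
  ring
end

section
/- Let μ be a finite positive Borel measure on ℝ with compact support whose orthonormal polynomials (q_n)_{n≥0} exist, q_n having positive leading coefficient k_n, and let p_n(z) = ∫ (q_n(z) − q_n(x))/(z − x) dμ(x) be the associated polynomial of the second kind. Then the n-th diagonal Padé approximant p_n/q_n of the Cauchy transform μ̂ satisfies z^{2n+1} · (μ̂(z) − p_n(z)/q_n(z)) → 1/k_n² as real z → +∞. -/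
open Polynomial MeasureTheory Filter

lemma ae_bdd_of_support (μ : Measure ℝ) (hcomp : IsCompact (measureSupport μ)) :
    ∃ R : ℝ, 0 < R ∧ ∀ᵐ x ∂μ, |x| ≤ R := by
  obtain ⟨R, hRpos, hR⟩ := hcomp.isBounded.exists_pos_norm_le
  refine ⟨R, hRpos, ?_⟩
  have h0 : μ (measureSupport μ)ᶜ = 0 := by
    refine measure_null_of_locally_null _ fun x hx => ?_
    have : ∃ U ∈ nhds x, μ U = 0 := by
      by_contra h
      push Not at h
      exact hx h
    obtain ⟨U, hU, h⟩ := this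
    exact ⟨U, mem_nhdsWithin_of_mem_nhds hU, h⟩
  have : ∀ᵐ x ∂μ, x ∈ measureSupport μ := h0
  filter_upwards [this] with x hx
  exact hR x hx

lemma integrable_aux (μ : Measure ℝ) [IsFiniteMeasure μ] {R : ℝ} (hR : ∀ᵐ x ∂μ, |x| ≤ R)
    (f : ℝ → ℝ) (hf : Measurable f) (hc : ContinuousOn f (Set.Icc (-R) R)) :
    Integrable f μ := by
  obtain ⟨C, hC⟩ := isCompact_Icc.exists_bound_of_continuousOn hc
  refine Integrable.of_bound hf.aestronglyMeasurable C ?_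
  filter_upwards [hR] with x hx
  exact hC x (abs_le.mp hx)

lemma degree_red (P Q : Polynomial ℝ) (m : ℕ) (hP : P.degree < (m + 1 : ℕ)) (hQ : Q.degree = m) :
    (P - C (P.coeff m / Q.leadingCoeff) * Q).degree < m := by
  have hQ0 : Q ≠ 0 := by
    rintro rfl
    simp at hQ
  have hl : Q.leadingCoeff ≠ 0 := leadingCoeff_ne_zero.mpr hQ0
  have hn : Q.natDegree = m := natDegree_eq_of_degree_eq_some hQ
  rw [degree_lt_iff_coeff_zero] at hP ⊢
  intro j hj
  rw [coeff_sub, coeff_C_mul]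
  rcases hj.eq_or_lt with rfl | hj
  · have : Q.coeff m = Q.leadingCoeff := by rw [leadingCoeff, hn]
    rw [this]
    field_simp
    simp
  · rw [hP j hj, coeff_eq_zero_of_natDegree_lt (p := Q) (n := j) (by omega)]
    simp

lemma pade_core (μ : Measure ℝ) [IsFiniteMeasure μ] {R : ℝ} (hR0 : 0 < R)
    (hR : ∀ᵐ x ∂μ, |x| ≤ R)
    (q : ℕ → Polynomial ℝ) (k : ℕ → ℝ)
    (hdeg : ∀ n : ℕ, (q n).degree = n)
    (hlead : ∀ n : ℕ, (q n).leadingCoeff = k n)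
    (hkpos : ∀ n : ℕ, 0 < k n)
    (horth : ∀ n m : ℕ,
      ∫ x, (q n).eval x * (q m).eval x ∂μ = if n = m then 1 else 0) (n : ℕ) :
    Tendsto
      (fun z : ℝ => z ^ (2 * n + 1) *
        ((∫ x, (z - x)⁻¹ ∂μ)
          - (∫ x, ((q n).eval z - (q n).eval x) / (z - x) ∂μ) / (q n).eval z))
      atTop (nhds (1 / (k n) ^ 2)) := by
  have hpi : ∀ P : Polynomial ℝ, Integrable (fun x => P.eval x) μ := fun P =>
    integrable_aux μ hR _ P.continuous.measurable P.continuous.continuousOn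
  have hpi2 : ∀ P Q : Polynomial ℝ, Integrable (fun x => P.eval x * Q.eval x) μ := fun P Q => by
    simpa using hpi (P * Q)
  have hstep : ∀ (P : Polynomial ℝ) (m : ℕ) (c : ℝ),
      ∫ x, (q n).eval x * P.eval x ∂μ =
        ∫ x, (q n).eval x * (P - C c * q m).eval x ∂μ +
          c * ∫ x, (q n).eval x * (q m).eval x ∂μ := by
    intro P m c
    rw [← integral_const_mul, ← integral_add (hpi2 _ _) ((hpi2 _ _).const_mul c)]
    congr 1
    ext x
    simp
    ring
  have hort : ∀ m : ℕ, m ≤ n → ∀ P : Polynomial ℝ, P.degree < m →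
      ∫ x, (q n).eval x * P.eval x ∂μ = 0 := by
    intro m
    induction m with
    | zero =>
      intro _ P hP
      have : P = 0 := by
        rw [← degree_eq_bot]
        simpa using hP
      simp [this]
    | succ m ih =>
      intro hm P hP
      rw [hstep P m (P.coeff m / (q m).leadingCoeff),
        ih (by omega) _ (degree_red P (q m) m hP (hdeg m)), horth, if_neg (by omega)]
      simp
  have hXn : ∫ x, (q n).eval x * x ^ n ∂μ = 1 / k n := by
    have h := hstep (X ^ n) n ((X ^ n : Polynomial ℝ).coeff n / (q n).leadingCoeff)
    rw [hort n le_rfl _ (degree_red (X ^ n) (q n) n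
      (by rw [degree_X_pow]; exact_mod_cast Nat.lt_succ_self n) (hdeg n)), horth, hlead] at h
    simpa using h
  have hlim1 : Tendsto (fun z : ℝ => z ^ n / (q n).eval z) atTop (nhds (1 / k n)) := by
    have := Polynomial.div_tendsto_leadingCoeff_div_of_degree_eq (X ^ n) (q n)
      (by rw [degree_X_pow, hdeg])
    simpa [hlead] using this
  have hlim2 : Tendsto (fun z : ℝ => ∫ x, (q n).eval x * x ^ n * (z / (z - x)) ∂μ) atTop
      (nhds (∫ x, (q n).eval x * x ^ n ∂μ)) := by
    have hint : Integrable (fun x => (q n).eval x * x ^ n) μ := by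
      simpa using hpi2 (q n) (X ^ n)
    refine tendsto_integral_filter_of_dominated_convergence
      (fun x => ‖(q n).eval x * x ^ n‖ * 2) ?_ ?_ (hint.norm.mul_const 2) ?_
    · filter_upwards with z
      exact ((((q n).continuous.measurable).mul (measurable_id.pow_const n)).mul
        (measurable_const.div (measurable_const.sub measurable_id))).aestronglyMeasurable
    · filter_upwards [eventually_gt_atTop (2 * R)] with z hz
      filter_upwards [hR] with x hx
      rw [norm_mul]
      gcongr
      have := (abs_le.mp hx).2
      rw [Real.norm_of_nonneg (div_nonneg (by linarith) (by linarith)),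
        div_le_iff₀ (by linarith)]
      linarith
    · filter_upwards with x
      have h1 : Tendsto (fun z : ℝ => z / (z - x)) atTop (nhds 1) := by
        have := Polynomial.div_tendsto_leadingCoeff_div_of_degree_eq (X : Polynomial ℝ) (X - C x)
          (by rw [degree_X, degree_X_sub_C])
        simpa using this
      simpa using h1.const_mul ((q n).eval x * x ^ n)
  have hlim := hlim1.mul hlim2
  rw [hXn] at hlim
  have e : 1 / k n * (1 / k n) = 1 / (k n) ^ 2 := by
    rw [div_mul_div_comm, one_mul, sq]
  rw [e] at hlim
  refine hlim.congr' ?_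
  have hq0 : q n ≠ 0 := by
    intro h
    have := hdeg n
    simp [h] at this
  have hne : ∀ᶠ z : ℝ in atTop, (q n).eval z ≠ 0 := by
    have := eventually_no_roots (q n) hq0
    simpa [IsRoot] using this
  filter_upwards [eventually_gt_atTop (2 * R), hne] with z hz hqz
  have hcont : ContinuousOn (fun x : ℝ => (z - x)⁻¹) (Set.Icc (-R) R) := by
    refine ContinuousOn.inv₀ (by fun_prop) fun x hx => ?_
    have := hx.2
    exact ne_of_gt (by linarith)
  have hmeas : Measurable (fun x : ℝ => (z - x)⁻¹) :=
    (measurable_const.sub measurable_id).inv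
  have hI : ∀ P : Polynomial ℝ, Integrable (fun x => P.eval x * (z - x)⁻¹) μ := fun P =>
    integrable_aux μ hR _ (P.continuous.measurable.mul hmeas) (P.continuous.continuousOn.mul hcont)
  have hI1 : Integrable (fun x => (z - x)⁻¹) μ := integrable_aux μ hR _ hmeas hcont
  have hxne : ∀ᵐ x ∂μ, z - x ≠ 0 := by
    filter_upwards [hR] with x hx
    have := (abs_le.mp hx).2
    exact ne_of_gt (by linarith)
  have hp : ∫ x, ((q n).eval z - (q n).eval x) / (z - x) ∂μ =
      (q n).eval z * ∫ x, (z - x)⁻¹ ∂μ - ∫ x, (q n).eval x * (z - x)⁻¹ ∂μ := by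
    rw [← integral_const_mul, ← integral_sub (hI1.const_mul _) (hI _)]
    congr 1
    ext x
    rw [div_eq_mul_inv, sub_mul]
  have hgeo : z ^ n * ∫ x, (q n).eval x * (z - x)⁻¹ ∂μ =
      ∫ x, (q n).eval x * x ^ n * (z - x)⁻¹ ∂μ := by
    have hI2 : Integrable (fun x => (q n).eval x * x ^ n * (z - x)⁻¹) μ := by
      exact (hI (q n * X ^ n)).congr (Eventually.of_forall fun x => by simp [eval_mul])
    rw [← sub_eq_zero, ← integral_const_mul, ← integral_sub ((hI _).const_mul _) hI2]
    rw [← hort n le_rfl (∑ i ∈ Finset.range n, C (z ^ i) * X ^ (n - 1 - i)) ?_]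
    · refine integral_congr_ae ?_
      filter_upwards [hxne] with x hx
      have hg := geom_sum₂_mul z x n
      simp only [eval_finsetSum, eval_mul, eval_C, eval_pow, eval_X]
      rw [eq_div_of_mul_eq hx hg]
      field_simp
    · refine (degree_lt_iff_coeff_zero _ _).mpr fun j hj => ?_
      rw [finsetSum_coeff]
      refine Finset.sum_eq_zero fun i hi => ?_
      rw [coeff_C_mul_X_pow, if_neg]
      have := Finset.mem_range.mp hi
      omega
  have hz2 : ∫ x, (q n).eval x * x ^ n * (z / (z - x)) ∂μ =
      z * ∫ x, (q n).eval x * x ^ n * (z - x)⁻¹ ∂μ := by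
    rw [← integral_const_mul]
    congr 1
    ext x
    rw [div_eq_mul_inv]
    ring
  rw [hz2, ← hgeo, hp]
  field_simp
  ring

/-- For the orthonormal polynomials `qₙ` (with positive leading coefficients `kₙ`) of a
compactly supported finite measure `μ` and the second-kind polynomials
`pₙ(z) = ∫ (qₙ(z) − qₙ(x))/(z − x) dμ(x)`, the diagonal Padé approximant `pₙ/qₙ` of the
Cauchy transform `μ̂` satisfies `z^{2n+1}(μ̂(z) − pₙ(z)/qₙ(z)) → 1/kₙ²` as real `z → +∞`. -/
theorem pade_error_asymptotics
    (μ : Measure ℝ) [IsFiniteMeasure μ]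
    (hcomp : IsCompact (measureSupport μ))
    (q : ℕ → Polynomial ℝ) (k : ℕ → ℝ)
    (hdeg : ∀ n : ℕ, (q n).degree = n)
    (hlead : ∀ n : ℕ, (q n).leadingCoeff = k n)
    (hkpos : ∀ n : ℕ, 0 < k n)
    (horth : ∀ n m : ℕ,
      ∫ x, (q n).eval x * (q m).eval x ∂μ = if n = m then 1 else 0) :
    ∀ n : ℕ, Tendsto
      (fun z : ℝ => z ^ (2 * n + 1) *
        ((∫ x, (z - x)⁻¹ ∂μ)
          - (∫ x, ((q n).eval z - (q n).eval x) / (z - x) ∂μ) / (q n).eval z))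
      atTop (nhds (1 / (k n) ^ 2)) := by
  intro n
  obtain ⟨R, hR0, hR⟩ := ae_bdd_of_support μ hcomp
  exact pade_core μ hR0 hR q k hdeg hlead hkpos horth n
end

section
/- Let g ≥ 0, let e_1 < e_2 < ⋯ < e_{2g+2} be real numbers, let z_1, …, z_g be real numbers, and set h(x) = ∏_{j=1}^{2g+2} (x − e_j) and X(x) = ∏_{j=1}^{g} (x − z_j). Then, as real x → +∞, the function x · ( x·X(x)/√(h(x)) − 1 ) tends to (1/2) ∑_{j=1}^{2g+2} e_j − ∑_{j=1}^{g} z_j, where √(h(x)) is the positive square root (h(x) > 0 for x > e_{2g+2}). -/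
open Filter

lemma hasDerivAt_prod_aux {n : ℕ} (a : Fin n → ℝ) :
    HasDerivAt (fun t : ℝ => ∏ j, (1 - t * a j)) (-∑ j, a j) 0 := by
  have h := HasDerivAt.fun_finset_prod (u := Finset.univ) (x := (0 : ℝ))
    (f := fun j t => 1 - t * a j) (f' := fun j => -a j)
    (fun j _ => by simpa using ((hasDerivAt_id (0 : ℝ)).mul_const (a j)).const_sub 1)
  simpa using h

lemma prod_scale_aux {n : ℕ} (a : Fin n → ℝ) {x : ℝ} (hx : 0 < x) :
    ∏ j, (x - a j) = x ^ n * ∏ j, (1 - x⁻¹ * a j) := by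
  have h : ∀ j, x - a j = x * (1 - x⁻¹ * a j) := fun j => by field_simp
  simp_rw [h, Finset.prod_mul_distrib]
  simp

/-- Second Laurent coefficient at infinity of `X(z)/√h(z)`:
for `h(x) = ∏_{j=1}^{2g+2}(x − e_j)` with `e₁ < ⋯ < e_{2g+2}` and
`X(x) = ∏_{j=1}^{g}(x − z_j)`, as real `x → +∞`,
`x·(x·X(x)/√h(x) − 1) → (1/2)∑ e_j − ∑ z_j`. -/
theorem laurent_coefficient_trace
    (g : ℕ) (e : Fin (2 * g + 2) → ℝ) (he : StrictMono e)
    (z : Fin g → ℝ) :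
    Tendsto
      (fun x : ℝ => x *
        (x * (∏ j, (x - z j)) / Real.sqrt (∏ j, (x - e j)) - 1))
      atTop
      (nhds ((1 / 2) * (∑ j, e j) - ∑ j, z j)) := by
  have hF := (hasDerivAt_prod_aux z).fun_div ((hasDerivAt_prod_aux e).sqrt (by simp)) (by simp)
  rw [hasDerivAt_iff_tendsto_slope_zero] at hF
  have hinv : Tendsto (fun x : ℝ => x⁻¹) atTop (nhdsWithin 0 {0}ᶜ) :=
    tendsto_inv_atTop_nhdsGT_zero.mono_right
      (nhdsWithin_mono _ fun y hy => ne_of_gt hy)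
  have hc := hF.comp hinv
  have hval : (1 / 2) * (∑ j, e j) - ∑ j, z j =
      (-∑ j, z j) + (∑ j, e j) / 2 := by ring
  rw [hval]
  simp [neg_div] at hc
  refine hc.congr' ?_
  filter_upwards [eventually_gt_atTop 0] with x hx
  have hs : Real.sqrt (x ^ (2 * g + 2)) = x ^ (g + 1) := by
    rw [show x ^ (2 * g + 2) = (x ^ (g + 1)) ^ 2 by ring]
    exact Real.sqrt_sq (by positivity)
  rw [prod_scale_aux z hx, prod_scale_aux e hx, Real.sqrt_mul (by positivity), hs,
    ← mul_assoc, ← pow_succ', mul_div_mul_left _ _ (by positivity)]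
  simp
end
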